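/- Let n ≥ 3 be odd, 1 ≤ k ≤ d, E ⊆ ℤ_n^d. If |E| ≫ √(τ(n))·n^{d + (k−1)/2} / γ(n)^{(d−1)/2}, then the set of dot-product k-simplices determined by E has size |P_k(E)| ≫ n^{k(k+1)/2}. -/

import Mathlib

open Finset

noncomputable def chi (n : ℕ) (t : ZMod n) : ℂ :=
  Complex.exp (2 * Real.pi * Complex.I * (t.val : ℂ) / (n : ℂ))

def dot {n d : ℕ} (x y : Fin d → ZMod n) : ZMod n := ∑ i, x i * y i

def nrm {n d : ℕ} (z : Fin d → ZMod n) : ZMod n := ∑ i, z i ^ 2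

noncomputable def ft (n d : ℕ) [NeZero n] (f : (Fin d → ZMod n) → ℂ)
    (m : Fin d → ZMod n) : ℂ :=
  (n : ℂ)⁻¹ ^ d * ∑ x : Fin d → ZMod n, f x * chi n (-(dot x m))

lemma sum_stdAddChar_sum_mul {n : ℕ} [NeZero n] {κ : Type*} [Fintype κ] [DecidableEq κ]
    (z : κ → ZMod n) :
    ∑ s : κ → ZMod n, (ZMod.stdAddChar (∑ i, s i * z i) : ℂ) =
      if z = 0 then (n : ℂ) ^ Fintype.card κ else 0 := by
  have h1 : ∀ s : κ → ZMod n, (ZMod.stdAddChar (∑ i, s i * z i) : ℂ) =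
      ∏ i, ZMod.stdAddChar (s i * z i) := fun s =>
    map_prod (ZMod.stdAddChar (N := n)).toMonoidHom (fun i => Multiplicative.ofAdd (s i * z i)) univ
  simp_rw [h1]
  rw [← Fintype.piFinset_univ,
    ← Finset.prod_univ_sum (fun _ => univ) (fun i a => (ZMod.stdAddChar (a * z i) : ℂ))]
  simp_rw [AddChar.sum_mulShift _ (ZMod.isPrimitive_stdAddChar n), ZMod.card]
  split_ifs with h
  · simp [h]
  · obtain ⟨i, hi⟩ := Function.ne_iff.1 h
    exact Finset.prod_eq_zero (mem_univ i) (by simp [show z i ≠ 0 from hi])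

/-- Resampling one coordinate of a uniformly chosen tuple does not change averages. -/
lemma sum_piFinset_update {ι V M : Type*} [Fintype ι] [DecidableEq ι] [AddCommMonoid M]
    (E : Finset V) (j : ι) (h : (ι → V) → M) :
    ∑ x ∈ Fintype.piFinset (fun _ : ι => E), ∑ y ∈ E, h (Function.update x j y) =
      E.card • ∑ x ∈ Fintype.piFinset (fun _ : ι => E), h x := by
  rw [← Finset.sum_nsmul]
  simp_rw [← Finset.sum_const]
  rw [← Finset.sum_product', ← Finset.sum_product']
  have key : ∀ p ∈ Fintype.piFinset (fun _ : ι => E) ×ˢ E,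
      (Function.update p.1 j p.2, p.1 j) ∈ Fintype.piFinset (fun _ : ι => E) ×ˢ E := by
    intro p hp
    simp only [mem_product, Fintype.mem_piFinset] at hp ⊢
    refine ⟨fun i => ?_, hp.1 j⟩
    rcases eq_or_ne i j with rfl | hij
    · simpa using hp.2
    · simpa [hij] using hp.1 i
  exact Finset.sum_nbij' (fun p => (Function.update p.1 j p.2, p.1 j))
    (fun p => (Function.update p.1 j p.2, p.1 j)) key key (by simp) (by simp) (by simp)

lemma card_filter_mul_eq_le {n : ℕ} [NeZero n] (s w : ZMod n) :
    (univ.filter fun a : ZMod n => s * a = w).card ≤ n.gcd s.val := by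
  rcases (univ.filter fun a : ZMod n => s * a = w).eq_empty_or_nonempty with h | ⟨b, hb⟩
  · simp [h]
  refine le_trans ?_ (IsAddCyclic.card_nsmul_eq_zero_le (α := ZMod n)
    (Nat.gcd_pos_of_pos_left s.val (NeZero.pos n)))
  refine Finset.card_le_card_of_injOn (· - b) (fun a ha => ?_) (fun a _ c _ h => by simpa using h)
  simp only [mem_filter, mem_univ, true_and, coe_filter, Set.mem_ofPred_eq] at ha hb ⊢
  have h0 : s * (a - b) = 0 := by rw [mul_sub, ha, hb, sub_self]
  rw [nsmul_eq_mul, ← Int.cast_natCast, Nat.gcd_eq_gcd_ab]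
  push_cast
  rw [ZMod.natCast_self, ZMod.natCast_zmod_val, zero_mul, zero_add, mul_right_comm, h0, zero_mul]

lemma card_filter_smul_eq_le {n d : ℕ} [NeZero n] (s : ZMod n) (w : Fin d → ZMod n) :
    (univ.filter fun a : Fin d → ZMod n => s • a = w).card ≤ n.gcd s.val ^ d := by
  have : (univ.filter fun a : Fin d → ZMod n => s • a = w) =
      Fintype.piFinset fun i => univ.filter fun a : ZMod n => s * a = w i := by
    ext a
    simp [funext_iff]
  rw [this, Fintype.card_piFinset]
  exact (Finset.prod_le_prod' fun i _ => card_filter_mul_eq_le s (w i)).trans (by simp)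

lemma sum_gcd_val_le (n : ℕ) [NeZero n] :
    ∑ s : ZMod n, n.gcd s.val ≤ n.divisors.card * n := by
  have h1 : ∑ s : ZMod n, n.gcd s.val = ∑ a ∈ range n, n.gcd a := by
    refine Finset.sum_nbij' (fun s => s.val) (fun a => (a : ZMod n)) ?_ ?_ ?_ ?_ ?_
    · intro s _
      simpa using ZMod.val_lt s
    · simp
    · simp
    · intro a ha
      exact ZMod.val_cast_of_lt (by simpa using ha)
    · simp
  rw [h1, ← Finset.sum_fiberwise_of_maps_to (t := n.divisors) (g := fun a => n.gcd a)
    (fun a _ => Nat.mem_divisors.2 ⟨Nat.gcd_dvd_left _ _, NeZero.ne n⟩)]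
  rw [← smul_eq_mul, ← Finset.sum_const]
  refine Finset.sum_le_sum fun h hh => ?_
  have hd := (Nat.mem_divisors.1 hh).1
  rw [Finset.sum_congr rfl (g := fun _ => h) (fun a ha => (mem_filter.1 ha).2), Finset.sum_const,
    ← Nat.totient_div_of_dvd hd, smul_eq_mul]
  exact (Nat.mul_le_mul_right h (Nat.totient_le _)).trans (Nat.div_mul_cancel hd).le

lemma gcd_val_mul_minFac_le {n : ℕ} [NeZero n] {s : ZMod n} (hs : s ≠ 0) :
    n.gcd s.val * n.minFac ≤ n := by
  obtain ⟨q, hq⟩ := Nat.gcd_dvd_left n s.val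
  have hn := NeZero.pos n
  have hval : 0 < s.val := Nat.pos_of_ne_zero (by simpa using hs)
  have hlt : n.gcd s.val < n := (Nat.gcd_le_right n hval).trans_lt (ZMod.val_lt s)
  have hq2 : 2 ≤ q := by
    by_contra! h
    interval_cases q <;> omega
  calc n.gcd s.val * n.minFac ≤ n.gcd s.val * q :=
        Nat.mul_le_mul_left _ (Nat.minFac_le_of_dvd hq2 ⟨_, hq.trans (mul_comm _ _)⟩)
    _ = n := hq.symm

lemma sum_gcd_val_pow_le {n d : ℕ} [NeZero n] (hd : 1 ≤ d) :
    ∑ s : ZMod n with s ≠ 0, (n.gcd s.val : ℝ) ^ d ≤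
      ((n : ℝ) / n.minFac) ^ (d - 1) * (n.divisors.card * n) := by
  have hγ : (0 : ℝ) < n.minFac := by exact_mod_cast n.minFac_pos
  calc ∑ s : ZMod n with s ≠ 0, (n.gcd s.val : ℝ) ^ d
      ≤ ∑ s : ZMod n with s ≠ 0, ((n : ℝ) / n.minFac) ^ (d - 1) * n.gcd s.val := by
        refine Finset.sum_le_sum fun s hs => ?_
        rw [← pow_sub_one_mul (by omega : d ≠ 0)]
        gcongr
        rw [le_div_iff₀ hγ]
        exact_mod_cast gcd_val_mul_minFac_le (mem_filter.1 hs).2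
    _ ≤ ∑ s : ZMod n, ((n : ℝ) / n.minFac) ^ (d - 1) * n.gcd s.val :=
        Finset.sum_le_sum_of_subset_of_nonneg (filter_subset _ _) fun _ _ _ => by positivity
    _ ≤ _ := by
        rw [← Finset.mul_sum]
        gcongr
        exact_mod_cast sum_gcd_val_le n

/-- A tree of depth `m` whose branching at level `j` is at most `K j` has at most `∏ j, K j`
leaves. -/
lemma card_le_prod_of_branching {V : Type*} [DecidableEq V] {m : ℕ} (F : Finset (Fin m → V))
    (K : Fin m → ℕ)
    (h : ∀ x ∈ F, ∀ j, ((F.filter fun x' => ∀ i < j, x' i = x i).image (· j)).card ≤ K j) :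
    F.card ≤ ∏ j, K j := by
  induction m with
  | zero => simpa using Finset.card_le_one_of_subsingleton F
  | succ m ih =>
    rw [Fin.prod_univ_castSucc, mul_comm]
    have hF := ih (F.image Fin.init) (fun j => K j.castSucc) (by
      intro x' hx' j
      obtain ⟨x, hx, rfl⟩ := mem_image.1 hx'
      refine le_trans (card_le_card ?_) (h x hx j.castSucc)
      intro v hv
      simp only [mem_image, mem_filter] at hv ⊢
      obtain ⟨_, ⟨⟨w, hw, rfl⟩, hwi⟩, rfl⟩ := hv
      refine ⟨w, ⟨hw, fun i hi => ?_⟩, rfl⟩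
      have := hwi (i.castLT (by have := Fin.lt_def.1 hi; simp at this; omega)) hi
      simpa [Fin.init] using this)
    refine le_trans (Finset.card_le_mul_card_image (f := Fin.init) F (K (Fin.last m)) ?_)
      (Nat.mul_le_mul_left _ hF)
    intro x' hx'
    obtain ⟨x, hx, rfl⟩ := mem_image.1 hx'
    refine le_trans ?_ (h x hx (Fin.last m))
    have hinit : ∀ w : Fin (m + 1) → V, Fin.init w = Fin.init x →
        ∀ i < Fin.last m, w i = x i := by
      intro w hw i hi
      have := congrFun hw (i.castLT hi)
      simpa [Fin.init] using this
    refine Finset.card_le_card_of_injOn (· (Fin.last m)) (fun w hw => ?_) fun w hw w' hw' he => ?_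
    · simp only [coe_filter, Set.mem_ofPred_eq] at hw
      simp only [coe_image, coe_filter]
      exact ⟨w, ⟨hw.1, hinit w hw.2⟩, rfl⟩
    · simp only [coe_filter, Set.mem_ofPred_eq] at hw hw'
      funext i
      rcases eq_or_ne i (Fin.last m) with rfl | hi
      · exact he
      · have hi := Fin.lt_last_iff_ne_last.2 hi
        rw [hinit w hw.2 i hi, hinit w' hw'.2 i hi]

lemma dot_sub {n d : ℕ} (u y y' : Fin d → ZMod n) : dot u (y - y') = dot u y - dot u y' := by
  simp [dot, mul_sub]

/-- The squared modulus of the unnormalized Fourier transform of the indicator of `E`. -/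
noncomputable def fourierSq {n d : ℕ} [NeZero n] (E : Finset (Fin d → ZMod n))
    (u : Fin d → ZMod n) : ℝ :=
  ‖∑ y ∈ E, (ZMod.stdAddChar (dot u y) : ℂ)‖ ^ 2

lemma fourierSq_eq_sum {n d : ℕ} [NeZero n] (E : Finset (Fin d → ZMod n))
    (u : Fin d → ZMod n) :
    (fourierSq E u : ℂ) = ∑ y ∈ E, ∑ y' ∈ E, (ZMod.stdAddChar (dot u (y - y')) : ℂ) := by
  rw [fourierSq, Complex.ofReal_pow, ← Complex.mul_conj', map_sum, Finset.sum_mul_sum]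
  refine Finset.sum_congr rfl fun y _ => Finset.sum_congr rfl fun y' _ => ?_
  rw [← AddChar.map_neg_eq_conj, ← AddChar.map_add_eq_mul, dot_sub, sub_eq_add_neg]

lemma fourierSq_zero {n d : ℕ} [NeZero n] (E : Finset (Fin d → ZMod n)) :
    fourierSq E 0 = (E.card : ℝ) ^ 2 := by
  simp [fourierSq, dot]

lemma sum_fourierSq {n d : ℕ} [NeZero n] (E : Finset (Fin d → ZMod n)) :
    ∑ u, fourierSq E u = (n : ℝ) ^ d * E.card := by
  apply Complex.ofReal_injective
  push_cast
  simp_rw [fourierSq_eq_sum]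
  rw [Finset.sum_comm]
  simp_rw [Finset.sum_comm (s := univ) (t := E), dot, sum_stdAddChar_sum_mul, sub_eq_zero]
  simp [Finset.sum_ite_eq, mul_comm]

lemma sum_fourierSq_sum_smul_le {n d : ℕ} [NeZero n] (E : Finset (Fin d → ZMod n))
    (hE : E.Nonempty) {ι : Type*} [Fintype ι] [DecidableEq ι] (J : Finset ι) (s : J → ZMod n)
    (j : J) :
    ∑ x ∈ Fintype.piFinset (fun _ : ι => E), fourierSq E (∑ i : J, s i • x i) ≤
      (E.card : ℝ) ^ Fintype.card ι * ((n.gcd (s j).val : ℝ) ^ d * (n : ℝ) ^ d) := by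
  have hN : (0 : ℝ) < E.card := by exact_mod_cast hE.card_pos
  have key : ∀ x : ι → Fin d → ZMod n,
      ∑ y ∈ E, fourierSq E (∑ i : J, s i • Function.update x j y i) ≤
        (n.gcd (s j).val : ℝ) ^ d * ((n : ℝ) ^ d * E.card) := by
    intro x
    have hsplit : ∀ y, ∑ i : J, s i • Function.update x j y i =
        s j • y + ∑ i ∈ univ.erase j, s i • x i := by
      intro y
      rw [← Finset.add_sum_erase _ _ (mem_univ j), Function.update_self]
      congr 1
      refine Finset.sum_congr rfl fun i hi => ?_
      rw [Function.update_of_ne fun h => (mem_erase.1 hi).1 (Subtype.ext h)]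
    simp_rw [hsplit]
    set c := ∑ i ∈ univ.erase j, s i • x i
    calc ∑ y ∈ E, fourierSq E (s j • y + c)
        ≤ ∑ y, fourierSq E (s j • y + c) :=
          Finset.sum_le_sum_of_subset_of_nonneg (subset_univ _) fun _ _ _ => by
            unfold fourierSq; positivity
      _ = ∑ u, ∑ y with s j • y + c = u, fourierSq E (s j • y + c) :=
          (Finset.sum_fiberwise _ _ _).symm
      _ ≤ ∑ u, (n.gcd (s j).val : ℝ) ^ d * fourierSq E u := by
          refine Finset.sum_le_sum fun u _ => ?_
          rw [Finset.sum_congr rfl (g := fun _ => fourierSq E u)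
            (fun a ha => by rw [(mem_filter.1 ha).2]), Finset.sum_const, nsmul_eq_mul]
          refine mul_le_mul_of_nonneg_right ?_ (by unfold fourierSq; positivity)
          simp_rw [← eq_sub_iff_add_eq]
          exact_mod_cast card_filter_smul_eq_le (s j) (u - c)
      _ = _ := by rw [← Finset.mul_sum, sum_fourierSq]
  have h := sum_piFinset_update E (j : ι) (fun x => fourierSq E (∑ i : J, s i • x i))
  rw [nsmul_eq_mul] at h
  refine le_of_mul_le_mul_left ?_ hN
  rw [← h]
  refine (Finset.sum_le_sum fun x _ => key x).trans ?_
  rw [Finset.sum_const, Fintype.card_piFinset, Finset.prod_const, Finset.card_univ, nsmul_eq_mul]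
  push_cast
  exact le_of_eq (by ring)

/-- The number of configurations `(x, y, y')` over `E` with `x i · y = x i · y'` for all `i ∈ J`. -/
def pinnedPairs {n d : ℕ} [NeZero n] (E : Finset (Fin d → ZMod n)) {ι : Type*} [Fintype ι]
    [DecidableEq ι] (J : Finset ι) : ℕ :=
  ∑ x ∈ Fintype.piFinset (fun _ : ι => E), ∑ y' ∈ E,
    (E.filter fun y => ∀ i ∈ J, dot (x i) y = dot (x i) y').card

lemma pow_mul_pinnedPairs {n d : ℕ} [NeZero n] (E : Finset (Fin d → ZMod n)) {ι : Type*}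
    [Fintype ι] [DecidableEq ι] (J : Finset ι) :
    (n : ℝ) ^ J.card * pinnedPairs E J =
      ∑ s : J → ZMod n, ∑ x ∈ Fintype.piFinset (fun _ : ι => E),
        fourierSq E (∑ i : J, s i • x i) := by
  apply Complex.ofReal_injective
  push_cast [pinnedPairs]
  have hdot : ∀ (x : ι → Fin d → ZMod n) (s : J → ZMod n) (z : Fin d → ZMod n),
      dot (∑ i : J, s i • x i) z = ∑ i : J, s i * dot (x i) z := by
    intro x s z
    simp only [dot, Finset.sum_apply, Pi.smul_apply, smul_eq_mul, Finset.sum_mul, Finset.mul_sum]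
    rw [Finset.sum_comm]
    simp only [mul_assoc]
  rw [Finset.sum_comm (s := univ), Finset.mul_sum]
  refine Finset.sum_congr rfl fun x _ => ?_
  simp_rw [fourierSq_eq_sum]
  refine Eq.trans ?_ (Finset.sum_comm.trans
    ((Finset.sum_congr rfl fun y _ => Finset.sum_comm).trans Finset.sum_comm)).symm
  rw [Finset.mul_sum]
  refine Finset.sum_congr rfl fun y' _ => ?_
  simp_rw [hdot, sum_stdAddChar_sum_mul (n := n) (fun i : J => dot (x i) _)]
  rw [← Finset.sum_filter, Finset.sum_const, nsmul_eq_mul, Fintype.card_coe, mul_comm]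
  congr 3
  ext y
  simp [funext_iff, dot_sub, sub_eq_zero]

lemma sum_apply_eq {ι V : Type*} [Fintype ι] [DecidableEq ι] [Fintype V] (j : ι) (g : V → ℝ) :
    (Fintype.card V : ℝ) * ∑ s : ι → V, g (s j) =
      (Fintype.card V : ℝ) ^ Fintype.card ι * ∑ a, g a := by
  classical
  have h := sum_piFinset_update (univ : Finset V) j (fun x => g (x j))
  simp only [Function.update_self, Fintype.piFinset_univ, Finset.sum_const, nsmul_eq_mul,
    Finset.card_univ, Fintype.card_fun] at h
  rw [← h]
  push_cast
  rfl

lemma pinnedPairs_le {n d : ℕ} [NeZero n] (hd : 1 ≤ d) (E : Finset (Fin d → ZMod n))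
    (hE : E.Nonempty) {ι : Type*} [Fintype ι] [DecidableEq ι] (J : Finset ι) :
    (pinnedPairs E J : ℝ) ≤ (E.card : ℝ) ^ (Fintype.card ι + 2) / (n : ℝ) ^ J.card +
      J.card * ((E.card : ℝ) ^ Fintype.card ι *
        ((n : ℝ) ^ d * (((n : ℝ) / n.minFac) ^ (d - 1) * n.divisors.card))) := by
  have hn : (0 : ℝ) < n := by exact_mod_cast NeZero.pos n
  set T : (J → ZMod n) → ℝ := fun s => ∑ x ∈ Fintype.piFinset (fun _ : ι => E),
    fourierSq E (∑ i : J, s i • x i) with hT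
  have hT0 : ∀ s, 0 ≤ T s := fun s => Finset.sum_nonneg fun _ _ => by unfold fourierSq; positivity
  have hTzero : T 0 = (E.card : ℝ) ^ (Fintype.card ι + 2) := by
    simp [hT, fourierSq_zero, pow_add]
  have hcoord : ∀ j : J, ∑ s with s j ≠ 0, T s ≤ (n : ℝ) ^ J.card * ((E.card : ℝ) ^ Fintype.card ι *
        ((n : ℝ) ^ d * (((n : ℝ) / n.minFac) ^ (d - 1) * n.divisors.card))) := by
    intro j
    set g : ZMod n → ℝ := fun a => if a ≠ 0 then (n.gcd a.val : ℝ) ^ d else 0 with hg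
    have h1 : ∑ s with s j ≠ 0, T s ≤
        (E.card : ℝ) ^ Fintype.card ι * (n : ℝ) ^ d * ∑ s : J → ZMod n, g (s j) := by
      rw [Finset.sum_filter, Finset.mul_sum]
      refine Finset.sum_le_sum fun s _ => ?_
      simp only [hg]
      split_ifs with h
      · exact (sum_fourierSq_sum_smul_le E hE J s j).trans (le_of_eq (by ring))
      · simp
    have h2 := sum_apply_eq j g
    rw [ZMod.card, Fintype.card_coe] at h2
    have h3 : ∑ a, g a ≤ ((n : ℝ) / n.minFac) ^ (d - 1) * (n.divisors.card * n) := by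
      rw [← Finset.sum_filter]
      exact sum_gcd_val_pow_le hd
    have h4 : ∑ s : J → ZMod n, g (s j) ≤
        (n : ℝ) ^ J.card * (((n : ℝ) / n.minFac) ^ (d - 1) * n.divisors.card) := by
      refine le_of_mul_le_mul_left ?_ hn
      rw [h2]
      refine (mul_le_mul_of_nonneg_left h3 (by positivity)).trans (le_of_eq (by ring))
    exact h1.trans ((mul_le_mul_of_nonneg_left h4 (by positivity)).trans (le_of_eq (by ring)))
  have hsum : ∑ s, T s ≤ T 0 + ∑ j : J, ∑ s with s j ≠ 0, T s := by
    rw [← Finset.add_sum_erase _ _ (mem_univ (0 : J → ZMod n))]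
    refine add_le_add_right ?_ _
    simp_rw [Finset.sum_filter]
    rw [Finset.sum_comm (s := univ (α := J)), ← Finset.add_sum_erase _ _ (mem_univ (0 : J → ZMod n))]
    refine le_add_of_nonneg_of_le (by simp) (Finset.sum_le_sum fun s hs => ?_)
    obtain ⟨j, hj⟩ := Function.ne_iff.1 (mem_erase.1 hs).1
    have := Finset.single_le_sum (f := fun j : J => if s j ≠ 0 then T s else 0)
      (fun i _ => by split_ifs <;> simp [hT0]) (mem_univ j)
    simpa [show s j ≠ 0 from hj] using this
  have hpos : (0 : ℝ) < (n : ℝ) ^ J.card := by positivity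
  refine le_of_mul_le_mul_left ?_ hpos
  rw [pow_mul_pinnedPairs, mul_add, mul_div_cancel₀ _ hpos.ne', ← hTzero]
  refine hsum.trans (add_le_add_right ((Finset.sum_le_sum fun j _ => hcoord j).trans ?_) _)
  rw [Finset.sum_const, Finset.card_univ, Fintype.card_coe, nsmul_eq_mul]
  exact le_of_eq (by ring)

lemma card_mul_sum_card_filter {n d : ℕ} [NeZero n] (E : Finset (Fin d → ZMod n)) {ι : Type*}
    [Fintype ι] [DecidableEq ι] (J : Finset ι) (j : ι) (hj : j ∉ J) :
    E.card * ∑ x ∈ Fintype.piFinset (fun _ : ι => E),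
      (E.filter fun y => ∀ i ∈ J, dot (x i) y = dot (x i) (x j)).card = pinnedPairs E J := by
  rw [← smul_eq_mul, ← sum_piFinset_update E j, pinnedPairs]
  refine Finset.sum_congr rfl fun x _ => Finset.sum_congr rfl fun y' _ => ?_
  congr 1
  refine Finset.filter_congr fun y _ => forall₂_congr fun i hi => ?_
  rw [Function.update_self, Function.update_of_ne (ne_of_mem_of_not_mem hi hj)]

lemma sum_card_filter_le {n k d : ℕ} [NeZero n] (hd : 1 ≤ d) (E : Finset (Fin d → ZMod n))
    (hE : E.Nonempty)
    (hlarge : (n : ℝ) ^ d * (((n : ℝ) / n.minFac) ^ (d - 1) * n.divisors.card) * (n : ℝ) ^ k ≤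
      (E.card : ℝ) ^ 2) (j : Fin (k + 1)) :
    (∑ x ∈ Fintype.piFinset (fun _ : Fin (k + 1) => E),
      ((E.filter fun y => ∀ i ∈ Iio j, dot (x i) y = dot (x i) (x j)).card : ℝ)) ≤
        (k + 1) * ((E.card : ℝ) ^ (k + 2) / (n : ℝ) ^ (j : ℕ)) := by
  have hN : (0 : ℝ) < E.card := by exact_mod_cast hE.card_pos
  have hn : (0 : ℝ) < n := by exact_mod_cast NeZero.pos n
  have hn1 : (1 : ℝ) ≤ n := by exact_mod_cast NeZero.pos n
  refine le_of_mul_le_mul_left ?_ hN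
  have h1 := card_mul_sum_card_filter E (Iio j) j (by simp)
  have h2 := pinnedPairs_le hd E hE (Iio j)
  rw [← h1, Fin.card_Iio, Fintype.card_fin] at h2
  push_cast at h2
  refine (le_of_eq (by congr!)).trans (h2.trans ?_)
  have hjk : (j : ℕ) ≤ k := Nat.lt_succ_iff.1 j.2
  have h3 : (n : ℝ) ^ d * (((n : ℝ) / n.minFac) ^ (d - 1) * n.divisors.card) ≤
      (E.card : ℝ) ^ 2 / (n : ℝ) ^ (j : ℕ) := by
    rw [le_div_iff₀ (by positivity)]
    refine le_trans ?_ hlarge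
    gcongr
  calc _ ≤ (E.card : ℝ) ^ (k + 1 + 2) / (n : ℝ) ^ (j : ℕ) +
        k * ((E.card : ℝ) ^ (k + 1) * ((E.card : ℝ) ^ 2 / (n : ℝ) ^ (j : ℕ))) := by
        gcongr
    _ = _ := by ring

lemma card_dotTypes_ge {n k d : ℕ} [NeZero n] (hd : 1 ≤ d) (E : Finset (Fin d → ZMod n))
    (hE : E.Nonempty)
    (hlarge : (n : ℝ) ^ d * (((n : ℝ) / n.minFac) ^ (d - 1) * n.divisors.card) * (n : ℝ) ^ k ≤
      (E.card : ℝ) ^ 2) :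
    (2 * (2 * ((k : ℝ) + 1) ^ 2) ^ (k + 1))⁻¹ * (n : ℝ) ^ (k * (k + 1) / 2) ≤
      (((Fintype.piFinset (fun _ : Fin (k + 1) => E)).image
          (fun x => fun p : {p : Fin (k + 1) × Fin (k + 1) // p.1 < p.2} =>
            dot (x p.1.1) (x p.1.2))).card : ℝ) := by
  have hN : (0 : ℝ) < E.card := by exact_mod_cast hE.card_pos
  have hn : (0 : ℝ) < n := by exact_mod_cast NeZero.pos n
  set A : ℝ := 2 * ((k : ℝ) + 1) ^ 2 with hA
  have hApos : 0 < A := by positivity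
  set X := Fintype.piFinset (fun _ : Fin (k + 1) => E) with hX
  set φ : (Fin (k + 1) → Fin d → ZMod n) →
      {p : Fin (k + 1) × Fin (k + 1) // p.1 < p.2} → ZMod n :=
    fun x p => dot (x p.1.1) (x p.1.2) with hφ
  set c : (Fin (k + 1) → Fin d → ZMod n) → Fin (k + 1) → ℕ :=
    fun x j => (E.filter fun y => ∀ i ∈ Iio j, dot (x i) y = dot (x i) (x j)).card
  set B : Fin (k + 1) → ℝ := fun j => A * (E.card / (n : ℝ) ^ (j : ℕ)) with hB
  have hBpos : ∀ j, 0 < B j := fun j => by positivity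
  have hXcard : (X.card : ℝ) = (E.card : ℝ) ^ (k + 1) := by
    rw [hX, Fintype.card_piFinset, Finset.prod_const, Finset.card_univ, Fintype.card_fin]
    push_cast
    rfl
  set G := X.filter fun x => ∀ j, (c x j : ℝ) ≤ B j
  have hbad : ∀ j, ((X.filter fun x => B j < c x j).card : ℝ) ≤
      (E.card : ℝ) ^ (k + 1) / (2 * (k + 1)) := by
    intro j
    refine le_of_mul_le_mul_right ?_ (hBpos j)
    calc ((X.filter fun x => B j < c x j).card : ℝ) * B j
        ≤ ∑ x ∈ X with B j < c x j, (c x j : ℝ) := by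
          rw [← nsmul_eq_mul]
          exact Finset.card_nsmul_le_sum _ _ _ fun x hx => (mem_filter.1 hx).2.le
      _ ≤ ∑ x ∈ X, (c x j : ℝ) :=
          Finset.sum_le_sum_of_subset_of_nonneg (filter_subset _ _) fun _ _ _ => by positivity
      _ ≤ (k + 1) * ((E.card : ℝ) ^ (k + 2) / (n : ℝ) ^ (j : ℕ)) :=
          sum_card_filter_le hd E hE hlarge j
      _ = _ := by
          simp only [hB, hA]
          field_simp
          ring
  have hGcard : (E.card : ℝ) ^ (k + 1) / 2 ≤ G.card := by
    have hcover : X ⊆ G ∪ univ.biUnion fun j => X.filter fun x => B j < c x j := by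
      intro x hx
      by_cases h : ∀ j, (c x j : ℝ) ≤ B j
      · exact mem_union_left _ (mem_filter.2 ⟨hx, h⟩)
      · push Not at h
        obtain ⟨j, hj⟩ := h
        exact mem_union_right _ (mem_biUnion.2 ⟨j, mem_univ j, mem_filter.2 ⟨hx, hj⟩⟩)
    have h1 : (X.card : ℝ) ≤ G.card + ∑ j, ((X.filter fun x => B j < c x j).card : ℝ) := by
      exact_mod_cast (card_le_card hcover).trans ((card_union_le _ _).trans
        (Nat.add_le_add_left card_biUnion_le _))
    have h2 : ∑ j, ((X.filter fun x => B j < c x j).card : ℝ) ≤ (E.card : ℝ) ^ (k + 1) / 2 := by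
      refine (Finset.sum_le_sum fun j _ => hbad j).trans (le_of_eq ?_)
      rw [Finset.sum_const, Finset.card_univ, Fintype.card_fin, nsmul_eq_mul]
      push_cast
      field_simp
    linarith
  have hfiber : ∀ t ∈ X.image φ, (G.filter fun x => φ x = t).card ≤ ∏ j, ⌊B j⌋₊ := by
    intro t _
    refine card_le_prod_of_branching _ _ fun x hx j => ?_
    obtain ⟨hxG, rfl⟩ := mem_filter.1 hx
    refine le_trans (card_le_card ?_) (Nat.le_floor ((mem_filter.1 hxG).2 j))
    intro v hv
    simp only [mem_image, mem_filter] at hv ⊢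
    obtain ⟨w, ⟨⟨hwG, hwt⟩, hwx⟩, rfl⟩ := hv
    refine ⟨Fintype.mem_piFinset.1 (mem_filter.1 hwG).1 j, fun i hi => ?_⟩
    have hij := mem_Iio.1 hi
    have := congrFun hwt ⟨(i, j), hij⟩
    simpa [hφ, hwx i hij] using this
  have hmain : (G.card : ℝ) ≤ (∏ j, B j) * (X.image φ).card := by
    have h1 := Finset.card_le_mul_card_image_of_maps_to
      (fun x hx => mem_image_of_mem φ (filter_subset _ X hx)) _ hfiber
    have h2 : (G.card : ℝ) ≤ (∏ j, (⌊B j⌋₊ : ℝ)) * (X.image φ).card := by exact_mod_cast h1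
    refine h2.trans ?_
    gcongr with j _
    exact Nat.floor_le (hBpos j).le
  have hprod : ∏ j, B j = A ^ (k + 1) * (E.card : ℝ) ^ (k + 1) / (n : ℝ) ^ (k * (k + 1) / 2) := by
    simp only [hB]
    rw [Finset.prod_mul_distrib, Finset.prod_div_distrib, Finset.prod_const, Finset.prod_const,
      Finset.prod_pow_eq_pow_sum, Finset.card_univ, Fintype.card_fin,
      Fin.sum_univ_eq_sum_range (fun i => i), Finset.sum_range_id, Nat.add_sub_cancel,
      mul_comm (k + 1) k, mul_div_assoc]
  rw [hprod] at hmain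
  have h := hGcard.trans hmain
  have hNpow : (0 : ℝ) < (E.card : ℝ) ^ (k + 1) := by positivity
  have hApow : (0 : ℝ) < A ^ (k + 1) := by positivity
  have hnpow : (0 : ℝ) < (n : ℝ) ^ (k * (k + 1) / 2) := by positivity
  rw [inv_mul_le_iff₀ (by positivity)]
  refine le_of_mul_le_mul_left ?_ hNpow
  have h' := mul_le_mul_of_nonneg_left h (by positivity : 0 ≤ 2 * (n : ℝ) ^ (k * (k + 1) / 2))
  calc _ = 2 * (n : ℝ) ^ (k * (k + 1) / 2) * ((E.card : ℝ) ^ (k + 1) / 2) := by ring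
    _ ≤ _ := h'
    _ = _ := by
      field_simp

theorem stmt19 (k d : ℕ) (hk : 1 ≤ k) (hkd : k ≤ d) :
    ∃ C > (0 : ℝ), ∃ c > (0 : ℝ), ∀ (n : ℕ) [NeZero n], Odd n → 3 ≤ n →
      ∀ E : Finset (Fin d → ZMod n),
      (E.card : ℝ) ≥ C * Real.sqrt (n.divisors.card) *
          (n : ℝ) ^ ((d : ℝ) + ((k : ℝ) - 1) / 2) /
          (n.minFac : ℝ) ^ (((d : ℝ) - 1) / 2) →
      ((((Fintype.piFinset (fun _ : Fin (k + 1) => E)).image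
          (fun x => fun p : {p : Fin (k + 1) × Fin (k + 1) // p.1 < p.2} =>
            dot (x p.1.1) (x p.1.2))).card : ℝ))
        ≥ c * (n : ℝ) ^ (k * (k + 1) / 2) := by
  refine ⟨1, one_pos, (2 * (2 * ((k : ℝ) + 1) ^ 2) ^ (k + 1))⁻¹, by positivity,
    fun n _ _ _ E hcard => ?_⟩
  have hn : (0 : ℝ) < n := by exact_mod_cast NeZero.pos n
  have hγ : (0 : ℝ) < n.minFac := by exact_mod_cast n.minFac_pos
  have hτ : (0 : ℝ) < n.divisors.card := by
    exact_mod_cast card_pos.2 (Nat.nonempty_divisors.2 (NeZero.ne n))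
  have hd : 1 ≤ d := hk.trans hkd
  have hpos : 0 < 1 * Real.sqrt (n.divisors.card) * (n : ℝ) ^ ((d : ℝ) + ((k : ℝ) - 1) / 2) /
      (n.minFac : ℝ) ^ (((d : ℝ) - 1) / 2) := by positivity
  have hE : E.Nonempty := card_pos.1 (by exact_mod_cast hpos.trans_le hcard)
  refine card_dotTypes_ge hd E hE ?_
  refine le_trans (le_of_eq ?_) (pow_le_pow_left₀ hpos.le hcard 2)
  have e1 : ((n : ℝ) ^ ((d : ℝ) + ((k : ℝ) - 1) / 2)) ^ 2 = (n : ℝ) ^ (d + (d - 1) + k) := by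
    rw [← Real.rpow_mul_natCast hn.le, ← Real.rpow_natCast]
    congr 1
    push_cast [Nat.cast_sub hd]
    ring
  have e2 : ((n.minFac : ℝ) ^ (((d : ℝ) - 1) / 2)) ^ 2 = (n.minFac : ℝ) ^ (d - 1) := by
    rw [← Real.rpow_mul_natCast hγ.le, ← Real.rpow_natCast]
    congr 1
    push_cast [Nat.cast_sub hd]
    ring
  rw [one_mul, div_pow _ _ 2, mul_pow, Real.sq_sqrt hτ.le, e1, e2, div_pow, pow_add, pow_add]
  ring
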